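/- There exist positive constants C₁ and C₂ with C₂ < 1 such that for all integers n ≥ 1 and all integers k with 1 ≤ k ≤ n the following holds. Set α = j_{n+1,k} and define, for r ∈ (0,1], F_r(r) = n·(J_n(αr) − J_n(α)·r^n)/(α²·r) and F_θ(r) = (α·(J_{n+1}(αr) − J_{n−1}(αr)) + 2n·J_n(α)·r^{n−1})/(2α²). Then for every δ with 0 ≤ δ < C₂ / j_{n+1,1}, ∫_{1−δ}^{1} r · (F_r(r)² + F_θ(r)²) dr ≤ C₁ · δ³ · J_n(α)². (Equivalently, the Stokes eigenfunction velocity u_{nk} on the unit disk, normalized so that its vorticity has unit L² norm, satisfies ‖u_{nk}‖²_{L²(Γ_δ)} ≤ C₁δ³ when δ < C₂·λ_{n,1}^{−1/2}, where λ_{n,1} = j_{n+1,1}².) -/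

import Mathlib

open Real MeasureTheory intervalIntegral

/-- The Bessel function of the first kind of (integer) order `n`, defined by its
everywhere-convergent power series. -/
noncomputable def besselJ (n : ℕ) (x : ℝ) : ℝ :=
  ∑' m : ℕ, ((-1 : ℝ) ^ m / (Nat.factorial m * Nat.factorial (m + n))) * (x / 2) ^ (2 * m + n)

/-- `x` is the `k`-th positive zero of `f` (for `k ≥ 1`): `x` is a positive zero of `f`
and there are exactly `k - 1` positive zeros of `f` below `x`. -/
def IsKthPosZero (f : ℝ → ℝ) (k : ℕ) (x : ℝ) : Prop :=
  0 < x ∧ f x = 0 ∧ {y : ℝ | 0 < y ∧ y < x ∧ f y = 0}.ncard = k - 1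

/-- The entire function with `besselJ n x = (x/2)^n * phi n (x^2/4)`. -/
noncomputable def phi (n : ℕ) (t : ℝ) : ℝ :=
  ∑' m : ℕ, ((-1 : ℝ) ^ m / (Nat.factorial m * Nat.factorial (m + n))) * t ^ m

lemma coef_abs_le (n m : ℕ) :
    |((-1 : ℝ) ^ m / (Nat.factorial m * Nat.factorial (m + n)))| ≤ 1 / Nat.factorial m := by
  rw [abs_div, abs_pow, abs_neg, abs_one, one_pow]
  have h1 : (0 : ℝ) < Nat.factorial m := by positivity
  have h2 : (1 : ℝ) ≤ Nat.factorial (m + n) := by exact_mod_cast Nat.factorial_pos _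
  rw [abs_of_pos (by positivity)]
  apply one_div_le_one_div_of_le h1
  nlinarith

lemma phi_summable (n : ℕ) (t : ℝ) :
    Summable fun m : ℕ => ((-1 : ℝ) ^ m / (Nat.factorial m * Nat.factorial (m + n))) * t ^ m := by
  refine Summable.of_norm_bounded (Real.summable_pow_div_factorial |t|) ?_
  intro m
  rw [norm_mul, norm_pow, Real.norm_eq_abs, Real.norm_eq_abs]
  have := mul_le_mul_of_nonneg_right (coef_abs_le n m) (pow_nonneg (abs_nonneg t) m)
  calc _ ≤ _ := this
    _ = _ := by ring

lemma besselJ_eq (n : ℕ) (x : ℝ) : besselJ n x = (x / 2) ^ n * phi n (x ^ 2 / 4) := by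
  unfold besselJ phi
  rw [← tsum_mul_left]
  congr 1
  ext m
  have : x ^ 2 / 4 = (x / 2) ^ 2 := by ring
  rw [this, pow_add, pow_mul]
  ring

lemma phi_zero (n : ℕ) : phi n 0 = 1 / Nat.factorial n := by
  unfold phi
  rw [tsum_eq_single 0]
  · simp
  · intro m hm
    simp [hm]

lemma phi_rec (n : ℕ) (t : ℝ) : phi n t = (n + 1) * phi (n + 1) t - t * phi (n + 2) t := by
  unfold phi
  have hs : Summable fun m : ℕ =>
      (m : ℝ) * (((-1 : ℝ) ^ m / (Nat.factorial m * Nat.factorial (m + (n + 1)))) * t ^ m) := by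
    rw [← summable_nat_add_iff 1]
    refine ((phi_summable (n + 2) t).mul_left (-t)).congr ?_
    intro m
    have h3 : m + 1 + (n + 1) = m + (n + 2) := by ring
    rw [h3, Nat.factorial_succ m]
    push_cast
    field_simp
    ring
  have h2 : t * ∑' m : ℕ, ((-1 : ℝ) ^ m / (Nat.factorial m * Nat.factorial (m + (n + 2)))) * t ^ m
      = - ∑' m : ℕ,
      (m : ℝ) * (((-1 : ℝ) ^ m / (Nat.factorial m * Nat.factorial (m + (n + 1)))) * t ^ m) := by
    rw [hs.tsum_eq_zero_add, ← tsum_mul_left]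
    simp only [Nat.cast_zero, zero_mul, zero_add]
    rw [← tsum_neg]
    congr 1
    ext m
    have h3 : m + 1 + (n + 1) = m + (n + 2) := by ring
    rw [h3, Nat.factorial_succ m]
    push_cast
    field_simp
    ring
  rw [h2, sub_neg_eq_add, ← tsum_mul_left,
    ← Summable.tsum_add ((phi_summable (n + 1) t).mul_left _) hs]
  congr 1
  ext m
  rw [← add_assoc m n 1, Nat.factorial_succ (m + n)]
  push_cast
  field_simp
  ring

lemma phi_hasDerivAt (n : ℕ) (t : ℝ) : HasDerivAt (phi n) (-phi (n + 1) t) t := by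
  set R : ℝ := |t| + 1 with hR
  have hR0 : 0 ≤ R := by positivity
  have hu : Summable fun m : ℕ => (m : ℝ) * (1 / Nat.factorial m) * R ^ (m - 1) := by
    rw [← summable_nat_add_iff 1]
    refine (Real.summable_pow_div_factorial R).congr ?_
    intro m
    rw [Nat.factorial_succ m]
    push_cast
    field_simp
  have key := hasDerivAt_tsum_of_isPreconnected (𝕜 := ℝ) (F := ℝ)
    (g := fun m y => ((-1 : ℝ) ^ m / (Nat.factorial m * Nat.factorial (m + n))) * y ^ m)
    (g' := fun m y => ((-1 : ℝ) ^ m / (Nat.factorial m * Nat.factorial (m + n))) *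
      (m * y ^ (m - 1)))
    (t := Metric.ball 0 R) (y₀ := 0) (y := t)
    hu Metric.isOpen_ball (convex_ball 0 R).isPreconnected
    (fun m y _ => (hasDerivAt_pow m y).const_mul _)
    (fun m y hy => by
      have hy' : |y| ≤ R := by
        have := Metric.mem_ball.1 hy
        rw [dist_zero_right, Real.norm_eq_abs] at this
        exact this.le
      rw [norm_mul, norm_mul, norm_pow, Real.norm_eq_abs, Real.norm_eq_abs, Real.norm_eq_abs,
        Nat.abs_cast]
      have h1 := coef_abs_le n m
      have h2 : |y| ^ (m - 1) ≤ R ^ (m - 1) := pow_le_pow_left₀ (abs_nonneg _) hy' _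
      calc _ ≤ (1 / (Nat.factorial m : ℝ)) * (m * R ^ (m - 1)) := by gcongr
        _ = _ := by ring)
    (Metric.mem_ball_self (by positivity))
    (phi_summable n 0)
    (by rw [Metric.mem_ball, dist_zero_right, Real.norm_eq_abs]; linarith)
  have he : (∑' m : ℕ, ((-1 : ℝ) ^ m / (Nat.factorial m * Nat.factorial (m + n))) *
      (m * t ^ (m - 1))) = - phi (n + 1) t := by
    have hs : Summable fun m : ℕ => ((-1 : ℝ) ^ m / (Nat.factorial m * Nat.factorial (m + n))) *
      (m * t ^ (m - 1)) := by
      rw [← summable_nat_add_iff 1]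
      refine (phi_summable (n + 1) t).neg.congr ?_
      intro m
      have h3 : m + 1 + n = m + (n + 1) := by ring
      rw [h3, Nat.factorial_succ m]
      push_cast
      field_simp
      simp [pow_succ, mul_comm]
    rw [hs.tsum_eq_zero_add]
    simp only [Nat.cast_zero, zero_mul, mul_zero, zero_add]
    unfold phi
    rw [← tsum_neg]
    congr 1
    ext m
    have h3 : m + 1 + n = m + (n + 1) := by ring
    rw [h3, Nat.factorial_succ m]
    push_cast
    field_simp
    simp [pow_succ, mul_comm]
  rw [he] at key
  exact key

/-- `J_ν` has no zero in `(0, ν)`. -/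
lemma zero_lower (n : ℕ) (T : ℝ) (hT : 0 < T) (hz : phi (n + 1) T = 0) :
    ((n : ℝ) + 1) ^ 2 ≤ 4 * T := by
  by_contra! hlt
  set H : ℝ → ℝ := fun t => t ^ (n + 1) *
    (phi (n + 1) t * (((n : ℝ) + 1) * phi (n + 1) t - 2 * t * phi (n + 2) t)) with hH
  have hd : ∀ t, HasDerivAt H (t ^ n / 2 * ((((n : ℝ) + 1) * phi (n + 1) t - 2 * t * phi (n + 2) t) ^ 2
      + (((n : ℝ) + 1) ^ 2 - 4 * t) * phi (n + 1) t ^ 2)) t := by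
    intro t
    have hp := phi_hasDerivAt (n + 1) t
    have hq := phi_hasDerivAt (n + 2) t
    have hr := phi_rec (n + 1) t
    have h := (hasDerivAt_pow (n + 1) t).mul (hp.mul ((hp.const_mul ((n : ℝ) + 1)).sub
      (((hasDerivAt_id t).const_mul 2).mul hq)))
    refine h.congr_deriv ?_
    simp only [Pi.mul_apply, Pi.sub_apply, id, Nat.add_sub_cancel, add_assoc] at *
    norm_num at *
    rw [pow_succ]
    have e : t * phi (n + 3) t = (n + 1 + 1) * phi (n + 2) t - phi (n + 1) t := by
      rw [hr]; ring
    linear_combination (t ^ n * t * phi (n + 1) t * 2) * e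
  have hmono : MonotoneOn H (Set.Icc 0 T) := by
    apply monotoneOn_of_deriv_nonneg (convex_Icc 0 T)
    · exact fun t _ => (hd t).continuousAt.continuousWithinAt
    · exact fun t _ => (hd t).differentiableAt.differentiableWithinAt
    · intro t ht
      rw [interior_Icc] at ht
      rw [(hd t).deriv]
      have h1 : 0 ≤ ((n : ℝ) + 1) ^ 2 - 4 * t := by linarith [ht.2]
      have h2 := ht.1.le
      positivity
  have hc : ContinuousAt (fun t => phi (n + 1) t *
      (((n : ℝ) + 1) * phi (n + 1) t - 2 * t * phi (n + 2) t)) 0 := by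
    have h1 := (phi_hasDerivAt (n + 1) 0).continuousAt
    have h2 := (phi_hasDerivAt (n + 2) 0).continuousAt
    fun_prop
  have hpos : (0 : ℝ) < phi (n + 1) 0 *
      (((n : ℝ) + 1) * phi (n + 1) 0 - 2 * 0 * phi (n + 2) 0) := by
    rw [phi_zero, mul_zero, zero_mul, sub_zero]
    positivity
  have hev := (hc.eventually (lt_mem_nhds hpos)).filter_mono
    (nhdsWithin_le_nhds (s := Set.Ioi 0))
  have hev2 : ∀ᶠ t in nhdsWithin (0 : ℝ) (Set.Ioi 0), t ∈ Set.Ioo 0 T := Ioo_mem_nhdsGT hT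
  obtain ⟨t, h1, h2⟩ := (hev.and hev2).exists
  have h3 : 0 < H t := mul_pos (pow_pos h2.1 _) h1
  have h4 := hmono ⟨h2.1.le, h2.2.le⟩ ⟨hT.le, le_rfl⟩ h2.2.le
  have h5 : H T = 0 := by simp [hH, hz]
  linarith

/-- A mean value bound on `[r,1]` -/
lemma mvt_bound (f f' : ℝ → ℝ) (r K : ℝ) (hr : r ≤ 1)
    (hf : ∀ s ∈ Set.Icc r 1, HasDerivAt f (f' s) s) (hb : ∀ s ∈ Set.Icc r 1, |f' s| ≤ K) :
    |f 1 - f r| ≤ K * (1 - r) := by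
  have := (convex_Icc r 1).norm_image_sub_le_of_norm_hasDerivWithin_le (f := f) (f' := f')
    (C := K) (x := r) (y := 1) (fun s hs => (hf s hs).hasDerivWithinAt) hb
    ⟨le_rfl, hr⟩ ⟨hr, le_rfl⟩
  rwa [Real.norm_eq_abs, Real.norm_eq_abs, abs_of_nonneg (sub_nonneg.2 hr)] at this

section profile

variable (n : ℕ) (c : ℝ)

lemma hasDerivAt_sq (r : ℝ) : HasDerivAt (fun r : ℝ => c * r ^ 2) (2 * c * r) r := by
  refine ((hasDerivAt_pow 2 r).const_mul c).congr_deriv ?_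
  norm_num
  ring

lemma u_deriv (r : ℝ) : HasDerivAt (fun r => phi n (c * r ^ 2))
    (-(2 * c * r) * phi (n + 1) (c * r ^ 2)) r := by
  refine ((phi_hasDerivAt n (c * r ^ 2)).comp r (hasDerivAt_sq c r)).congr_deriv ?_
  ring

lemma rv_deriv (r : ℝ) : HasDerivAt (fun r => r ^ (2 * n + 2) * phi (n + 1) (c * r ^ 2))
    (2 * r ^ (2 * n + 1) * phi n (c * r ^ 2)) r := by
  refine ((hasDerivAt_pow (2 * n + 2) r).mul (u_deriv (n + 1) c r)).congr_deriv ?_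
  rw [phi_rec n (c * r ^ 2)]
  push_cast
  ring

lemma energy_bound (hc : 0 ≤ c) (hz : phi (n + 1) c = 0) (r : ℝ) (hr0 : 0 ≤ r) (hr1 : r ≤ 1) :
    r ^ (2 * n + 1) * |phi n (c * r ^ 2)| ≤ |phi n c| := by
  set E : ℝ → ℝ := fun r => r ^ (4 * n + 2) * phi n (c * r ^ 2) ^ 2
    + c * (r ^ (2 * n + 2) * phi (n + 1) (c * r ^ 2)) ^ 2 with hE
  have hd : ∀ r, HasDerivAt E ((4 * n + 2) * r ^ (4 * n + 1) * phi n (c * r ^ 2) ^ 2) r := by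
    intro r
    refine (((hasDerivAt_pow (4 * n + 2) r).mul ((u_deriv n c r).pow 2)).add
      (((rv_deriv n c r).pow 2).const_mul c)).congr_deriv ?_
    rw [show 4 * n + 2 - 1 = 4 * n + 1 by omega]
    push_cast
    simp only [Pi.pow_apply]
    ring
  have hmono : MonotoneOn E (Set.Ici 0) := by
    apply monotoneOn_of_deriv_nonneg (convex_Ici 0)
    · exact fun t _ => (hd t).continuousAt.continuousWithinAt
    · exact fun t _ => (hd t).differentiableAt.differentiableWithinAt
    · intro t ht
      rw [interior_Ici] at ht
      have := le_of_lt (Set.mem_Ioi.1 ht)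
      rw [(hd t).deriv]
      positivity
  have h := hmono (Set.mem_Ici.2 hr0) (Set.mem_Ici.2 zero_le_one) hr1
  have h1 : E 1 = phi n c ^ 2 := by simp [hE, hz]
  rw [h1] at h
  have h2 : (r ^ (2 * n + 1) * phi n (c * r ^ 2)) ^ 2 ≤ phi n c ^ 2 := by
    have : 0 ≤ c * (r ^ (2 * n + 2) * phi (n + 1) (c * r ^ 2)) ^ 2 := by positivity
    have e : (r ^ (2 * n + 1) * phi n (c * r ^ 2)) ^ 2 =
      r ^ (4 * n + 2) * phi n (c * r ^ 2) ^ 2 := by ring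
    rw [e]
    simp only [hE] at h
    linarith
  have h3 := sq_le_sq.1 h2
  rwa [abs_mul, abs_of_nonneg (pow_nonneg hr0 _)] at h3

lemma profile_bounds (hc : 0 ≤ c) (hz : phi (n + 1) c = 0) (d : ℝ) (hd : 0 ≤ d)
    (hd2 : (n + 1) * d ≤ 1 / 2) (r : ℝ) (hr : r ∈ Set.Icc (1 - d) 1) :
    |phi (n + 1) (c * r ^ 2)| ≤ 32 * |phi n c| * (1 - r) ∧
    |phi n (c * r ^ 2) - phi n c| ≤ 64 * c * |phi n c| * (1 - r) ^ 2 := by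
  have hd1 : d ≤ 1 / 2 := by nlinarith [(Nat.cast_nonneg n : (0 : ℝ) ≤ n)]
  set U := |phi n c| with hU
  have hU0 : 0 ≤ U := abs_nonneg _
  have hpow : ∀ s ∈ Set.Icc (1 - d) 1, 1 / 2 ≤ s ^ (n + 1) := by
    intro s hs
    have h1 : 1 + ((n + 1 : ℕ) : ℝ) * (-d) ≤ (1 + -d) ^ (n + 1) :=
      one_add_mul_le_pow (by linarith) _
    have h2 : (1 + -d) ^ (n + 1) ≤ s ^ (n + 1) :=
      pow_le_pow_left₀ (by linarith) (by linarith [hs.1]) _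
    push_cast at h1
    linarith
  have hs01 : ∀ s ∈ Set.Icc (1 - d) 1, 0 ≤ s ∧ s ≤ 1 := fun s hs => ⟨by linarith [hs.1], hs.2⟩
  have hpow2 : ∀ s ∈ Set.Icc (1 - d) 1, 1 / 4 ≤ s ^ (2 * n + 2) := by
    intro s hs
    have := hpow s hs
    rw [show 2 * n + 2 = (n + 1) * 2 by ring, pow_mul]
    nlinarith
  have hu : ∀ s ∈ Set.Icc (1 - d) 1, |phi n (c * s ^ 2)| ≤ 4 * U := by
    intro s hs
    have h1 := energy_bound n c hc hz s (hs01 s hs).1 (hs01 s hs).2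
    have h2 := hpow2 s hs
    have h3 : s ^ (2 * n + 2) ≤ s ^ (2 * n + 1) :=
      pow_le_pow_of_le_one (hs01 s hs).1 (hs01 s hs).2 (by omega)
    nlinarith [abs_nonneg (phi n (c * s ^ 2))]
  have hv : ∀ s ∈ Set.Icc (1 - d) 1, |phi (n + 1) (c * s ^ 2)| ≤ 32 * U * (1 - s) := by
    intro s hs
    have h := mvt_bound _ _ s (8 * U) hs.2 (fun x _ => rv_deriv n c x) (fun x hx => by
      have hx' : x ∈ Set.Icc (1 - d) 1 := ⟨hs.1.trans hx.1, hx.2⟩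
      have h1 := hu x hx'
      have h0 := (hs01 x hx').1
      have h2 : x ^ (2 * n + 1) ≤ 1 := pow_le_one₀ h0 hx.2
      have h3 : 0 ≤ x ^ (2 * n + 1) := pow_nonneg h0 _
      rw [abs_mul, abs_mul, abs_two, abs_of_nonneg h3]
      nlinarith [abs_nonneg (phi n (c * x ^ 2))])
    simp only [one_pow, mul_one, one_mul, hz, zero_sub, abs_neg] at h
    rw [abs_mul, abs_of_nonneg (pow_nonneg (hs01 s hs).1 _)] at h
    have h2 := hpow2 s hs
    nlinarith [abs_nonneg (phi (n + 1) (c * s ^ 2))]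
  refine ⟨hv r hr, ?_⟩
  have h := mvt_bound _ _ r (64 * c * U * (1 - r)) hr.2 (fun x _ => u_deriv n c x) (fun x hx => by
      have hx' : x ∈ Set.Icc (1 - d) 1 := ⟨hr.1.trans hx.1, hx.2⟩
      have h1 := hv x hx'
      have h0 := (hs01 x hx').1
      rw [abs_mul, abs_neg, abs_of_nonneg (by positivity : 0 ≤ 2 * c * x)]
      have h4 : |phi (n + 1) (c * x ^ 2)| ≤ 32 * U * (1 - r) :=
        h1.trans (by nlinarith [hx.1])
      calc 2 * c * x * |phi (n + 1) (c * x ^ 2)|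
          ≤ 2 * c * 1 * (32 * U * (1 - r)) := by
            apply mul_le_mul _ h4 (abs_nonneg _) (by positivity)
            exact mul_le_mul_of_nonneg_left hx.2 (by positivity)
        _ = _ := by ring)
  simp only [one_pow, mul_one] at h
  rw [abs_sub_comm]
  calc _ ≤ _ := h
    _ = _ := by ring

end profile

lemma integrand_bound (n : ℕ) (hn : 1 ≤ n) (a : ℝ) (ha : 0 < a) (hz : besselJ (n + 1) a = 0)
    (d : ℝ) (hd : 0 ≤ d) (hd2 : (n + 1) * d ≤ 1 / 2) (r : ℝ) (hr : r ∈ Set.Icc (1 - d) 1) :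
    r * (((n : ℝ) * (besselJ n (a * r) - besselJ n a * r ^ n) / (a ^ 2 * r)) ^ 2 +
       ((a * (besselJ (n + 1) (a * r) - besselJ (n - 1) (a * r)) +
          2 * (n : ℝ) * besselJ n a * r ^ (n - 1)) / (2 * a ^ 2)) ^ 2) ≤
      1600 * d ^ 2 * besselJ n a ^ 2 := by
  obtain ⟨k, rfl⟩ : ∃ k, n = k + 1 := ⟨n - 1, by omega⟩
  have hz' : phi (k + 1 + 1) (a ^ 2 / 4) = 0 := by
    rw [besselJ_eq] at hz
    exact (mul_eq_zero.1 hz).resolve_left (by positivity)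
  obtain ⟨hv, hu⟩ := profile_bounds (k + 1) (a ^ 2 / 4) (by positivity) hz' d hd hd2 r hr
  have hrec := phi_rec k (a ^ 2 / 4 * r ^ 2)
  have hsq : (a * r) ^ 2 / 4 = a ^ 2 / 4 * r ^ 2 := by ring
  simp only [besselJ_eq, Nat.add_sub_cancel, hsq, hrec]
  set u := phi (k + 1) (a ^ 2 / 4 * r ^ 2)
  set v := phi (k + 1 + 1) (a ^ 2 / 4 * r ^ 2) with hvdef
  set U := phi (k + 1) (a ^ 2 / 4)
  have hn0 : (0 : ℝ) ≤ (k + 1 : ℕ) := Nat.cast_nonneg _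
  set N : ℝ := ((k + 1 : ℕ) : ℝ) with hN
  have hNk : (k : ℝ) + 1 = N := by simp [hN]
  rw [hNk]
  have hNd : N * d ≤ 1 / 2 := by nlinarith
  have hd1 : d ≤ 1 / 2 := by nlinarith
  have hr0 : 1 / 2 ≤ r := by linarith [hr.1]
  have hrp : 0 < r := by linarith
  have hr1 := hr.2
  have hdr : 1 - r ≤ d := by linarith [hr.1]
  have hdr0 : 0 ≤ 1 - r := by linarith
  set A := (a / 2) ^ (k + 1) with hA
  have hA0 : 0 < A := by positivity
  have hU0 := abs_nonneg U
  have hv2 : |v| ≤ 32 * |U| * d := hv.trans (by gcongr)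
  have hu2 : |u - U| ≤ 16 * a ^ 2 * |U| * d ^ 2 :=
    hu.trans (by
      calc _ ≤ 64 * (a ^ 2 / 4) * |U| * d ^ 2 := by gcongr
        _ = _ := by ring)
  have hNu : N * |u - U| ≤ 8 * a ^ 2 * |U| * d := by
    calc _ ≤ N * (16 * a ^ 2 * |U| * d ^ 2) := by gcongr
      _ = (N * d) * (16 * a ^ 2 * |U| * d) := by ring
      _ ≤ (1 / 2) * (16 * a ^ 2 * |U| * d) := by gcongr
      _ = _ := by ring
  have e1 : N * ((a * r / 2) ^ (k + 1) * u - A * U * r ^ (k + 1)) / (a ^ 2 * r)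
      = A * r ^ k * (N * (u - U)) / a ^ 2 := by
    have : (a * r / 2) ^ (k + 1) = A * r ^ k * r := by
      rw [hA, mul_assoc, ← pow_succ, ← mul_pow]; ring
    rw [this, pow_succ r k]
    field_simp
  have e2 : (a * ((a * r / 2) ^ (k + 1 + 1) * v - (a * r / 2) ^ k *
      (N * u - a ^ 2 / 4 * r ^ 2 * v)) + 2 * N * (A * U) * r ^ k) / (2 * a ^ 2)
      = A * r ^ k * (a ^ 2 * r ^ 2 * v - 2 * (N * (u - U))) / (2 * a ^ 2) := by
    have h1 : (a * r / 2) = (a / 2) * r := by ring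
    have h2 : A = (a / 2) ^ k * (a / 2) := by rw [hA, pow_succ]
    rw [h1, mul_pow, mul_pow, h2, pow_succ (a / 2) (k + 1), pow_succ (a / 2) k]
    congr 1
    ring
  rw [e1, e2]
  have hrk1 : r ^ k ≤ 1 := pow_le_one₀ hrp.le hr1
  have hrk0 : 0 ≤ r ^ k := by positivity
  have hM : |A * U| = A * |U| := by rw [abs_mul, abs_of_pos hA0]
  have b1 : |A * r ^ k * (N * (u - U)) / a ^ 2| ≤ 8 * d * |A * U| := by
    rw [abs_div, abs_mul, abs_mul, abs_mul, abs_of_pos hA0, abs_of_nonneg hrk0, abs_of_nonneg hn0,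
      abs_of_pos (by positivity : 0 < a ^ 2), hM, div_le_iff₀ (by positivity)]
    calc A * r ^ k * (N * |u - U|) ≤ A * 1 * (8 * a ^ 2 * |U| * d) := by gcongr
      _ = _ := by ring
  have b2 : |A * r ^ k * (a ^ 2 * r ^ 2 * v - 2 * (N * (u - U))) / (2 * a ^ 2)|
      ≤ 24 * d * |A * U| := by
    have h1 : |a ^ 2 * r ^ 2 * v - 2 * (N * (u - U))| ≤ 48 * a ^ 2 * |U| * d := by
      refine (abs_sub _ _).trans ?_
      rw [abs_mul, abs_mul 2, abs_mul N, abs_two, abs_of_nonneg hn0,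
        abs_of_nonneg (by positivity : 0 ≤ a ^ 2 * r ^ 2)]
      have hr2 : r ^ 2 ≤ 1 := pow_le_one₀ hrp.le hr1
      have : a ^ 2 * r ^ 2 * |v| ≤ a ^ 2 * 1 * (32 * |U| * d) := by gcongr
      linarith
    rw [abs_div, abs_mul, abs_mul, abs_of_pos hA0, abs_of_nonneg hrk0,
      abs_of_pos (by positivity : 0 < 2 * a ^ 2), hM, div_le_iff₀ (by positivity)]
    calc _ ≤ A * 1 * (48 * a ^ 2 * |U| * d) := by gcongr
      _ = _ := by ring
  have s1 := pow_le_pow_left₀ (abs_nonneg _) b1 2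
  have s2 := pow_le_pow_left₀ (abs_nonneg _) b2 2
  rw [sq_abs, mul_pow, sq_abs] at s1 s2
  have hnn : 0 ≤ d ^ 2 * (A * U) ^ 2 := by positivity
  calc _ ≤ 1 * ((8 * d) ^ 2 * (A * U) ^ 2 + (24 * d) ^ 2 * (A * U) ^ 2) := by gcongr
    _ ≤ _ := by nlinarith

/-- There exist `C₁ > 0` and `0 < C₂ < 1` such that for all `n ≥ 1`, `1 ≤ k ≤ n`, with
`a = j (n+1) k` and the radial and tangential velocity profiles `F_r`, `F_θ` of the
Stokes eigenfunction, the boundary-layer energy satisfies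
`(Integral r (F_r(r)^2 + F_θ(r)^2) on [1-d,1]) ≤ C₁ d^3 J_n(a)^2`
whenever `0 ≤ d < C₂ / j (n+1) 1`. -/
theorem velocity_boundary_layer_bound (j : ℕ → ℕ → ℝ)
    (hj : ∀ n k, 1 ≤ k → IsKthPosZero (besselJ n) k (j n k)) :
    ∃ C₁ C₂ : ℝ, 0 < C₁ ∧ 0 < C₂ ∧ C₂ < 1 ∧
      ∀ (n k : ℕ), 1 ≤ n → 1 ≤ k → k ≤ n →
        ∀ δ : ℝ, 0 ≤ δ → δ < C₂ / j (n + 1) 1 →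
          (∫ r in (1 - δ)..1, r *
              (((n : ℝ) * (besselJ n (j (n + 1) k * r) - besselJ n (j (n + 1) k) * r ^ n) /
                  ((j (n + 1) k) ^ 2 * r)) ^ 2 +
               ((j (n + 1) k *
                    (besselJ (n + 1) (j (n + 1) k * r) - besselJ (n - 1) (j (n + 1) k * r)) +
                  2 * (n : ℝ) * besselJ n (j (n + 1) k) * r ^ (n - 1)) /
                  (2 * (j (n + 1) k) ^ 2)) ^ 2)) ≤
            C₁ * δ ^ 3 * (besselJ n (j (n + 1) k)) ^ 2 := by
  refine ⟨1600, 1 / 2, by norm_num, by norm_num, by norm_num, ?_⟩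
  intro n k hn hk _ δ hδ hδ2
  obtain ⟨ha, hz, _⟩ := hj (n + 1) k hk
  obtain ⟨hb, hzb, _⟩ := hj (n + 1) 1 le_rfl
  generalize j (n + 1) k = a at *
  generalize j (n + 1) 1 = b at *
  have hzb' : phi (n + 1) (b ^ 2 / 4) = 0 := by
    rw [besselJ_eq] at hzb
    exact (mul_eq_zero.1 hzb).resolve_left (by positivity)
  have hlow := zero_lower n (b ^ 2 / 4) (by positivity) hzb'
  have hlow2 : (n : ℝ) + 1 ≤ b := by
    apply abs_le_of_sq_le_sq' _ hb.le |>.2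
    linarith
  have hd2 : ((n : ℝ) + 1) * δ ≤ 1 / 2 := by
    have h1 : δ * b < 1 / 2 := (lt_div_iff₀ hb).1 hδ2
    nlinarith
  have hle : 1 - δ ≤ 1 := by linarith
  have hb : ∀ r ∈ Set.uIoc (1 - δ) 1, _ := fun r hr =>
    integrand_bound n hn a ha hz δ hδ hd2 r (Set.Ioc_subset_Icc_self (Set.uIoc_of_le hle ▸ hr))
  have hbound := intervalIntegral.norm_integral_le_of_norm_le_const (a := 1 - δ) (b := 1)
    (fun r hr => by
      have hr' := Set.uIoc_of_le hle ▸ hr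
      have hr0 : 0 ≤ r := by nlinarith [hr'.1, (Nat.cast_nonneg n : (0 : ℝ) ≤ n)]
      refine le_trans (le_of_eq ?_) (hb r hr)
      rw [Real.norm_eq_abs, abs_of_nonneg]
      exact mul_nonneg hr0 (by positivity))
  rw [Real.norm_eq_abs] at hbound
  refine (le_abs_self _).trans (hbound.trans (le_of_eq ?_))
  rw [sub_sub_cancel, abs_of_nonneg hδ]
  ring
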